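/- arXiv:2309.01704 — 11 statements merged into one kernel-verified Lean document; each statement's English description precedes it below -/
import Mathlib

section
/- Let F be a nonempty finite set of Boolean vectors f : Fin m → Bool containing at least one vector that is not identically false, and suppose F is closed under pointwise alternative denial (NAND): for all f, g ∈ F, the vector j ↦ ¬(f j ∧ g j) belongs to F. Then there exists a column j : Fin m such that 2 * |{f ∈ F : f j = true}| ≥ |F|. -/
theorem stmt_1 (m : ℕ) (F : Finset (Fin m → Bool))
    (hne : F.Nonempty)
    (hnz : ∃ f ∈ F, f ≠ fun _ => false)
    (hnand : ∀ f ∈ F, ∀ g ∈ F, (fun j => !(f j && g j)) ∈ F) :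
    ∃ j : Fin m, 2 * (F.filter (fun f => f j = true)).card ≥ F.card := by
  obtain ⟨f₀, -, hf₀⟩ := hnz
  obtain ⟨j, -⟩ := Function.ne_iff.mp hf₀
  refine ⟨j, ?_⟩
  have hle : (F.filter (fun f => ¬ f j = true)).card ≤ (F.filter (fun f => f j = true)).card := by
    refine Finset.card_le_card_of_injOn (fun f k => !(f k && f k)) ?_ ?_
    · intro f hf
      simp only [Finset.coe_filter, Set.mem_ofPred_eq] at hf ⊢
      exact ⟨hnand f hf.1 f hf.1, by simpa using hf.2⟩
    · intro f _ g _ hfg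
      funext k
      simpa using congrFun hfg k
  have hsum := Finset.card_filter_add_card_filter_not (s := F) (fun f => f j = true)
  omega
end

section
/- Let F be a nonempty finite set of Boolean vectors f : Fin m → Bool containing at least one vector that is not identically false, and suppose F is closed under pointwise joint denial (NOR): for all f, g ∈ F, the vector j ↦ ¬(f j ∨ g j) belongs to F. Then there exists a column j : Fin m such that 2 * |{f ∈ F : f j = true}| ≥ |F|. -/
theorem stmt_2 (m : ℕ) (F : Finset (Fin m → Bool))
    (hne : F.Nonempty)
    (hnz : ∃ f ∈ F, f ≠ fun _ => false)
    (hnor : ∀ f ∈ F, ∀ g ∈ F, (fun j => !(f j || g j)) ∈ F) :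
    ∃ j : Fin m, 2 * (F.filter (fun f => f j = true)).card ≥ F.card := by
  obtain ⟨f, -, hf⟩ := hnz
  obtain ⟨j, -⟩ := Function.ne_iff.mp hf
  refine ⟨j, ?_⟩
  have hcompl : (F.filter (fun f => ¬ f j = true)).card ≤
      (F.filter (fun f => f j = true)).card := by
    refine Finset.card_le_card_of_injOn (fun f i => !f i) ?_ ?_
    · intro g hg
      have hg' := Finset.mem_filter.mp hg
      refine Finset.mem_coe.mpr (Finset.mem_filter.mpr ⟨?_, ?_⟩)
      · simpa using hnor g hg'.1 g hg'.1
      · simpa using hg'.2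
    · intro g _ h _ hgh
      funext i
      simpa using congrFun hgh i
  have hsum := F.card_filter_add_card_filter_not (fun f => f j = true)
  omega
end

section
/- For every natural number n ≥ 2, the set F of Boolean vectors of length n consisting of the n standard unit vectors e_i (where e_i j = true iff i = j) together with the identically false vector has the following properties: F has n + 1 elements, F contains a vector that is not identically false, F is closed under pointwise conjunction (f, g) ↦ (j ↦ f j ∧ g j) and under pointwise abjunction (f, g) ↦ (j ↦ f j ∧ ¬(g j)), yet for every column j : Fin n we have 2 * |{f ∈ F : f j = true}| < |F|, i.e., no column contains ones in at least half of the rows. -/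
theorem injective_decide_eq (n : ℕ) :
    Function.Injective (fun i : Fin n => fun j : Fin n => decide (i = j)) := by
  intro a b h
  simpa using (congrFun h b)

theorem stmt_3 (n : ℕ) (hn : 2 ≤ n)
    (F : Finset (Fin n → Bool))
    (hF : F = insert (fun _ => false)
      ((Finset.univ : Finset (Fin n)).image (fun i => fun j => decide (i = j)))) :
    F.card = n + 1 ∧
    (∃ f ∈ F, f ≠ fun _ => false) ∧
    (∀ f ∈ F, ∀ g ∈ F, (fun j => f j && g j) ∈ F) ∧
    (∀ f ∈ F, ∀ g ∈ F, (fun j => f j && !(g j)) ∈ F) ∧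
    (∀ j : Fin n, 2 * (F.filter (fun f => f j = true)).card < F.card) := by
  have unit_ne (i : Fin n) : (fun j => decide (i = j)) ≠ fun _ => false := fun h => by
    simpa using congrFun h i
  have mem_iff (f : Fin n → Bool) :
      f ∈ F ↔ f = (fun _ => false) ∨ ∃ i, (fun j => decide (i = j)) = f := by
    simp [hF]
  have card_F : F.card = n + 1 := by
    rw [hF, Finset.card_insert_of_notMem,
      Finset.card_image_of_injective _ (injective_decide_eq n), Finset.card_fin]
    simpa using unit_ne
  -- Masking a row of `F` by any vector gives that row or the zero row.
  have mask_mem (f : Fin n → Bool) (hf : f ∈ F) (g : Fin n → Bool) :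
      (fun j => f j && g j) ∈ F := by
    rw [mem_iff] at hf ⊢
    obtain rfl | ⟨i, rfl⟩ := hf
    · simp
    · cases hg : g i
      · left
        funext j
        by_cases h : i = j
        · simp [← h, hg]
        · simp [h]
      · refine .inr ⟨i, ?_⟩
        funext j
        by_cases h : i = j
        · simp [← h, hg]
        · simp [h]
  refine ⟨card_F, ⟨fun j => decide ((⟨0, by omega⟩ : Fin n) = j),
    (mem_iff _).2 (.inr ⟨_, rfl⟩), unit_ne _⟩, fun f hf g _ => mask_mem f hf g,
    fun f hf g _ => mask_mem f hf fun j => !(g j), fun j => ?_⟩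
  have column_card : (F.filter (fun f => f j = true)).card ≤ 1 := by
    refine (Finset.card_le_card (t := {fun k => decide (j = k)}) fun f hf => ?_).trans
      (Finset.card_singleton _).le
    rw [Finset.mem_filter, mem_iff] at hf
    obtain ⟨rfl | ⟨i, rfl⟩, h⟩ := hf
    · simp at h
    · have hij : i = j := by simpa using h
      simp [hij]
  omega
end

section
/- For all natural numbers k and n with 1 ≤ k ≤ n, there exists a set F of n + 2 distinct Boolean vectors of length n + 1 such that: F contains a vector that is not identically false, F is closed under pointwise conjunction (f, g) ↦ (j ↦ f j ∧ g j), the maximum over all columns j of the number |{f ∈ F : f j = true}| equals k + 1, and consequently, whenever n > 2k, no column of F contains ones in at least half of the rows (i.e., 2 * |{f ∈ F : f j = true}| < |F| for every column j). -/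
/-- The indicator vector of `{i}` when `k < i`, and of `{0, i}` when `i ≤ k`. -/
def petal (k n : ℕ) (i j : Fin (n + 1)) : Bool :=
  decide (j = i ∨ (i.val ≤ k ∧ j = 0))

/-- The zero vector together with all the petals. -/
def petalFamily (k n : ℕ) : Finset (Fin (n + 1) → Bool) :=
  insert (fun _ => false) (Finset.univ.image (petal k n))

theorem petal_self (k n : ℕ) (i : Fin (n + 1)) : petal k n i i = true := by
  simp [petal]

theorem petal_injective (k n : ℕ) : Function.Injective (petal k n) := by
  intro a b h
  have ha : petal k n b a = true := by rw [← h]; exact petal_self k n a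
  have hb : petal k n a b = true := by rw [h]; exact petal_self k n b
  simp only [petal, decide_eq_true_eq] at ha hb
  grind

theorem zero_notMem_image_petal (k n : ℕ) :
    (fun _ => false) ∉ Finset.univ.image (petal k n) := by
  simp only [Finset.mem_image, Finset.mem_univ, true_and, not_exists]
  intro i h
  have := petal_self k n i
  simp [h] at this

theorem card_petalFamily (k n : ℕ) : (petalFamily k n).card = n + 2 := by
  rw [petalFamily, Finset.card_insert_of_notMem (zero_notMem_image_petal k n),
    Finset.card_image_of_injective _ (petal_injective k n)]
  simp

theorem petal_mem_petalFamily (k n : ℕ) (i : Fin (n + 1)) :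
    petal k n i ∈ petalFamily k n := by
  simp [petalFamily]

theorem petal_and_mem_petalFamily (k n : ℕ) (a b : Fin (n + 1)) :
    (fun j => petal k n a j && petal k n b j) ∈ petalFamily k n := by
  by_cases hab : a = b
  · subst hab
    simpa using petal_mem_petalFamily k n a
  by_cases h : a.val ≤ k ∧ b.val ≤ k
  · convert petal_mem_petalFamily k n 0 using 1
    funext j
    rw [Bool.eq_iff_iff]
    simp only [petal, Bool.and_eq_true, decide_eq_true_eq]
    grind
  · have hz : (fun j => petal k n a j && petal k n b j) = fun _ => false := by
      funext j
      have h0 : (0 : Fin (n + 1)).val = 0 := rfl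
      rw [Bool.eq_iff_iff]
      simp only [petal, Bool.and_eq_true, decide_eq_true_eq]
      grind
    rw [hz]
    exact Finset.mem_insert_self _ _

theorem and_mem_petalFamily (k n : ℕ) {f g : Fin (n + 1) → Bool}
    (hf : f ∈ petalFamily k n) (hg : g ∈ petalFamily k n) :
    (fun j => f j && g j) ∈ petalFamily k n := by
  have hz : (fun _ => false) ∈ petalFamily k n := Finset.mem_insert_self _ _
  rcases Finset.mem_insert.1 hf with rfl | hf
  · simpa using hz
  rcases Finset.mem_insert.1 hg with rfl | hg
  · simpa using hz
  obtain ⟨a, -, rfl⟩ := Finset.mem_image.1 hf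
  obtain ⟨b, -, rfl⟩ := Finset.mem_image.1 hg
  exact petal_and_mem_petalFamily k n a b

theorem card_filter_petalFamily (k n : ℕ) (j : Fin (n + 1)) :
    ((petalFamily k n).filter (fun f => f j = true)).card =
      (Finset.univ.filter (fun i => petal k n i j = true)).card := by
  rw [petalFamily, Finset.filter_insert, if_neg (by simp), Finset.filter_image,
    Finset.card_image_of_injective _ (petal_injective k n)]

theorem card_filter_petalFamily_zero {k n : ℕ} (hkn : k ≤ n) :
    ((petalFamily k n).filter (fun f => f 0 = true)).card = k + 1 := by
  have h : Finset.univ.filter (fun i => petal k n i 0 = true) =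
      Finset.Iic (⟨k, Nat.lt_succ_of_le hkn⟩ : Fin (n + 1)) := by
    ext i
    have h0 : (0 : Fin (n + 1)).val = 0 := rfl
    simp only [petal, Finset.mem_filter, Finset.mem_univ, true_and, decide_eq_true_eq,
      Finset.mem_Iic, Fin.le_def]
    grind
  rw [card_filter_petalFamily, h, Fin.card_Iic]

theorem card_filter_petalFamily_of_ne_zero (k n : ℕ) {j : Fin (n + 1)} (hj : j ≠ 0) :
    ((petalFamily k n).filter (fun f => f j = true)).card = 1 := by
  rw [card_filter_petalFamily, Finset.card_eq_one]
  refine ⟨j, ?_⟩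
  ext i
  simp [petal, hj, eq_comm]

theorem stmt_4 (k n : ℕ) (hk : 1 ≤ k) (hkn : k ≤ n) :
    ∃ F : Finset (Fin (n + 1) → Bool),
      F.card = n + 2 ∧
      (∃ f ∈ F, f ≠ fun _ => false) ∧
      (∀ f ∈ F, ∀ g ∈ F, (fun j => f j && g j) ∈ F) ∧
      (∃ j : Fin (n + 1), (F.filter (fun f => f j = true)).card = k + 1) ∧
      (∀ j : Fin (n + 1), (F.filter (fun f => f j = true)).card ≤ k + 1) ∧
      (n > 2 * k →
        ∀ j : Fin (n + 1), 2 * (F.filter (fun f => f j = true)).card < F.card) := by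
  have hle : ∀ j : Fin (n + 1),
      ((petalFamily k n).filter (fun f => f j = true)).card ≤ k + 1 := by
    intro j
    by_cases hj : j = 0
    · rw [hj, card_filter_petalFamily_zero hkn]
    · rw [card_filter_petalFamily_of_ne_zero k n hj]
      omega
  refine ⟨petalFamily k n, card_petalFamily k n,
    ⟨petal k n 0, petal_mem_petalFamily k n 0, fun h => ?_⟩,
    fun f hf g hg => and_mem_petalFamily k n hf hg,
    ⟨0, card_filter_petalFamily_zero hkn⟩, hle, fun hn j => ?_⟩
  · simpa [h] using petal_self k n 0
  · have := hle j
    rw [card_petalFamily]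
    omega
end

section
/- Let F be a nonempty finite set of Boolean vectors f : Fin m → Bool containing at least one vector that is not identically false, and suppose F is closed under pointwise biconditional: for all f, g ∈ F, the vector j ↦ (f j = g j) (true exactly when f j and g j agree) belongs to F. Then there exists a column j : Fin m such that 2 * |{f ∈ F : f j = true}| ≥ |F|. -/
theorem stmt_5 (m : ℕ) (F : Finset (Fin m → Bool))
    (hne : F.Nonempty)
    (hnz : ∃ f ∈ F, f ≠ fun _ => false)
    (hiff : ∀ f ∈ F, ∀ g ∈ F, (fun j => f j == g j) ∈ F) :
    ∃ j : Fin m, 2 * (F.filter (fun f => f j = true)).card ≥ F.card := by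
  obtain ⟨f, -, hf⟩ := hnz
  obtain ⟨j, -⟩ := Function.ne_iff.mp hf
  refine ⟨j, ?_⟩
  have hsplit := F.card_filter_add_card_filter_not (fun f => f j = true)
  suffices h : (F.filter (fun f => ¬ f j = true)).card ≤
      (F.filter (fun f => f j = true)).card by omega
  by_cases hex : ∃ h ∈ F, h j = false
  · obtain ⟨h, hF, hj⟩ := hex
    refine Finset.card_le_card_of_injOn (fun g i => h i == g i) ?_ ?_
    · intro g hg
      simp only [Finset.coe_filter, Set.mem_ofPred_eq] at hg ⊢
      exact ⟨hiff h hF g hg.1, by simp_all⟩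
    · intro a _ b _ hab
      funext i
      have hi : (h i == a i) = (h i == b i) := congrFun hab i
      revert hi
      cases h i <;> cases a i <;> cases b i <;> simp
  · push Not at hex
    rw [Finset.filter_false_of_mem (fun g hg => by simpa using hex g hg)]
    simp
end

section
/- Let X be a nonempty finite topological space. Then there exists a point x₀ ∈ X that belongs to at least half of the open sets of X: 2 * |{U : Set X | IsOpen U ∧ x₀ ∈ U}| ≥ |{U : Set X | IsOpen U}|, where both collections are finite since X is finite. -/
/-- A minimal nonempty open set is disjoint from every open set missing one of its points. -/
theorem disjoint_of_minimal_isOpen {X : Type*} [TopologicalSpace X] {M U : Set X}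
    (hM : Minimal (fun V : Set X ↦ IsOpen V ∧ V.Nonempty) M) (hU : IsOpen U) {x : X}
    (hxM : x ∈ M) (hxU : x ∉ U) : Disjoint U M := by
  rw [Set.disjoint_iff_inter_eq_empty, ← Set.not_nonempty_iff_eq_empty]
  exact fun h ↦ hxU (hM.le_of_le ⟨hU.inter hM.prop.1, h⟩ Set.inter_subset_right hxM).1

theorem stmt_7 (X : Type*) [Fintype X] [Nonempty X] [TopologicalSpace X] :
    ∃ x₀ : X,
      2 * Set.ncard {U : Set X | IsOpen U ∧ x₀ ∈ U} ≥ Set.ncard {U : Set X | IsOpen U} := by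
  obtain ⟨M, hM⟩ := (Set.toFinite {V : Set X | IsOpen V ∧ V.Nonempty}).exists_minimal
    ⟨Set.univ, isOpen_univ, Set.univ_nonempty⟩
  obtain ⟨x, hx⟩ := hM.prop.2
  refine ⟨x, ?_⟩
  have hle : {U : Set X | IsOpen U ∧ x ∉ U}.ncard ≤ {U : Set X | IsOpen U ∧ x ∈ U}.ncard := by
    refine Set.ncard_le_ncard_of_injOn (· ∪ M)
      (fun U hU ↦ ⟨hU.1.union hM.prop.1, Or.inr hx⟩) ?_
    intro U hU V hV hUV
    rw [← (disjoint_of_minimal_isOpen hM hU.1 hx hU.2).sup_sdiff_cancel_right,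
      ← (disjoint_of_minimal_isOpen hM hV.1 hx hV.2).sup_sdiff_cancel_right]
    exact congrArg (· \ M) hUV
  have hunion : {U : Set X | IsOpen U} =
      {U : Set X | IsOpen U ∧ x ∈ U} ∪ {U : Set X | IsOpen U ∧ x ∉ U} := by
    ext U
    simp only [Set.mem_ofPred_eq, Set.mem_union]
    tauto
  rw [hunion]
  have := Set.ncard_union_le {U : Set X | IsOpen U ∧ x ∈ U} {U : Set X | IsOpen U ∧ x ∉ U}
  omega
end

section
/- Let F be a nonempty finite set of Boolean vectors f : Fin m → Bool containing at least one vector that is not identically false, and suppose F is closed under both pointwise conjunction (f, g) ↦ (j ↦ f j ∧ g j) and pointwise disjunction (f, g) ↦ (j ↦ f j ∨ g j). Then there exists a column j : Fin m such that 2 * |{f ∈ F : f j = true}| ≥ |F|. -/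
theorem stmt_8 (m : ℕ) (F : Finset (Fin m → Bool))
    (hne : F.Nonempty)
    (hnz : ∃ f ∈ F, f ≠ fun _ => false)
    (hand : ∀ f ∈ F, ∀ g ∈ F, (fun j => f j && g j) ∈ F)
    (hor : ∀ f ∈ F, ∀ g ∈ F, (fun j => f j || g j) ∈ F) :
    ∃ j : Fin m, 2 * (F.filter (fun f => f j = true)).card ≥ F.card := by
  obtain ⟨f₀, hf₀, hf₀z⟩ := hnz
  -- Pick a minimal nonzero member `a` and a column in its support.
  obtain ⟨a, ha⟩ := (F.filter (fun f => f ≠ fun _ => false)).exists_minimal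
    ⟨f₀, Finset.mem_filter.2 ⟨hf₀, hf₀z⟩⟩
  obtain ⟨haF, haz⟩ := Finset.mem_filter.1 ha.prop
  obtain ⟨j, hj⟩ := Function.ne_iff.1 haz
  have haj : a j = true := by simpa using hj
  -- Members vanishing at `j` are disjoint from `a`, by minimality.
  have disjoint_a : ∀ f ∈ F, ¬ f j = true → ∀ i, (f i && a i) = false := by
    intro f hf hfj
    by_contra hcon
    have hmem : (fun i => f i && a i) ∈ F.filter (fun f => f ≠ fun _ => false) :=
      Finset.mem_filter.2 ⟨hand f hf a haF, fun h => hcon fun i => congrFun h i⟩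
    have hle : (fun i => f i && a i) ≤ a := fun i => Bool.and_le_right (f i) (a i)
    have h : (f j && a j) = true := ha.le_of_le hmem hle j haj
    simp [hfj] at h
  refine ⟨j, ?_⟩
  have hcard : (F.filter (fun f => ¬ f j = true)).card ≤
      (F.filter (fun f => f j = true)).card := by
    refine Finset.card_le_card_of_injOn (fun f i => f i || a i) ?_ ?_
    · intro f hf
      have hf := Finset.mem_filter.1 hf
      exact Finset.mem_filter.2 ⟨hor f hf.1 a haF, by simp [haj]⟩
    · intro f hf g hg hfg
      have hf := Finset.mem_filter.1 hf
      have hg := Finset.mem_filter.1 hg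
      funext i
      have h₁ := disjoint_a f hf.1 hf.2 i
      have h₂ := disjoint_a g hg.1 hg.2 i
      have h₃ : (f i || a i) = (g i || a i) := congrFun hfg i
      revert h₁ h₂ h₃
      cases f i <;> cases g i <;> cases a i <;> simp
  have hsum := Finset.card_filter_add_card_filter_not (s := F) (fun f => f j = true)
  omega
end

section
/- Let F be a nonempty finite family of sets (a finite set of subsets of a type X). If B and C are both bases for F, then B = C. (That is, if a basis for a finite family of sets exists, it is unique.) -/
/-- `B` is a basis for the finite family `F` of subsets of `X`: every member of `B`
belongs to `F` and is nonempty, distinct members of `B` are disjoint, and every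
member of `F` is the union of some subcollection of `B`. -/
def IsSetFamilyBasis {X : Type*} (F B : Finset (Set X)) : Prop :=
  (∀ b ∈ B, b ∈ F) ∧
  (∀ b ∈ B, b.Nonempty) ∧
  (∀ b ∈ B, ∀ c ∈ B, b ≠ c → b ∩ c = ∅) ∧
  (∀ A ∈ F, ∃ S : Finset (Set X), S ⊆ B ∧ A = ⋃₀ (S : Set (Set X)))

namespace IsSetFamilyBasis

variable {X : Type*} {F B C : Finset (Set X)}

/-- Every point of a member of the family lies in a basis element contained in that member. -/
theorem exists_mem_subset (hB : IsSetFamilyBasis F B) {A : Set X} (hA : A ∈ F) {x : X}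
    (hx : x ∈ A) : ∃ b ∈ B, x ∈ b ∧ b ⊆ A := by
  obtain ⟨S, hS, rfl⟩ := hB.2.2.2 A hA
  obtain ⟨b, hb, hxb⟩ := hx
  exact ⟨b, hS hb, hxb, Set.subset_sUnion_of_mem hb⟩

/-- Basis elements sharing a point are equal. -/
theorem eq_of_mem_of_mem (hB : IsSetFamilyBasis F B) {b c : Set X} (hb : b ∈ B) (hc : c ∈ B)
    {x : X} (hxb : x ∈ b) (hxc : x ∈ c) : b = c := by
  by_contra hne
  exact (hB.2.2.1 b hb c hc hne).subset ⟨hxb, hxc⟩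

theorem subset (hB : IsSetFamilyBasis F B) (hC : IsSetFamilyBasis F C) : B ⊆ C := by
  intro b hb
  obtain ⟨x, hxb⟩ := hB.2.1 b hb
  obtain ⟨c, hc, hxc, hcb⟩ := hC.exists_mem_subset (hB.1 b hb) hxb
  obtain ⟨b', hb', hxb', hb'c⟩ := hB.exists_mem_subset (hC.1 c hc) hxc
  obtain rfl := hB.eq_of_mem_of_mem hb hb' hxb hxb'
  exact hb'c.antisymm hcb ▸ hc

end IsSetFamilyBasis

theorem stmt_9 {X : Type*} (F : Finset (Set X)) (hne : F.Nonempty)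
    (B C : Finset (Set X)) (hB : IsSetFamilyBasis F B) (hC : IsSetFamilyBasis F C) :
    B = C := by
  exact (hB.subset hC).antisymm (hC.subset hB)
end

section
/- Let F be a nonempty finite family of subsets of a type X such that for all A, D ∈ F, both A \ D ∈ F and A ∩ D ∈ F. Then F has a basis B (a collection of pairwise disjoint nonempty members of F) with the property that every A ∈ F can be written as A = ⋃₀ S for a unique subcollection S ⊆ B; that is, every member of F is uniquely determined by the members of B it is composed of. -/
/-- In a finite family closed under differences and intersections, every point of a member `A`
lies in a minimal nonempty member contained in `A`. -/
theorem exists_minimal_nonempty_mem_subset {X : Type*} {F : Finset (Set X)}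
    (hdiff : ∀ A ∈ F, ∀ D ∈ F, A \ D ∈ F) {A : Set X} (hA : A ∈ F) {x : X} (hx : x ∈ A) :
    ∃ b, Minimal (fun c => c ∈ F ∧ c.Nonempty) b ∧ x ∈ b ∧ b ⊆ A := by
  classical
  obtain ⟨b, hbA, hb⟩ := (F.filter (x ∈ ·)).exists_le_minimal (Finset.mem_filter.2 ⟨hA, hx⟩)
  obtain ⟨hbF, hxb⟩ := Finset.mem_filter.1 hb.prop
  refine ⟨b, ⟨⟨hbF, x, hxb⟩, ?_⟩, hxb, hbA⟩
  rintro c ⟨hcF, y, hyc⟩ hcb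
  by_cases hxc : x ∈ c
  · exact hb.le_of_le (Finset.mem_filter.2 ⟨hcF, hxc⟩) hcb
  · have h := hb.le_of_le (Finset.mem_filter.2 ⟨hdiff b hbF c hcF, hxb, hxc⟩) Set.sdiff_subset
    exact absurd hyc (h (hcb hyc)).2

/-- Distinct minimal nonempty members of a family closed under intersections are disjoint. -/
theorem inter_eq_empty_of_minimal_of_ne {X : Type*} {F : Finset (Set X)}
    (hinter : ∀ A ∈ F, ∀ D ∈ F, A ∩ D ∈ F) {b c : Set X}
    (hb : Minimal (fun d => d ∈ F ∧ d.Nonempty) b)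
    (hc : Minimal (fun d => d ∈ F ∧ d.Nonempty) c) (hbc : b ≠ c) : b ∩ c = ∅ := by
  by_contra h
  have hmem : b ∩ c ∈ F ∧ (b ∩ c).Nonempty :=
    ⟨hinter b hb.prop.1 c hc.prop.1, Set.nonempty_iff_ne_empty.2 h⟩
  exact hbc <| (hb.eq_of_le hmem Set.inter_subset_left).symm.trans
    <| hc.eq_of_le hmem Set.inter_subset_right

/-- A subcollection of a collection of pairwise disjoint nonempty sets consists of exactly those
members contained in its union. -/
theorem mem_iff_subset_sUnion_of_disjoint {X : Type*} {B S : Finset (Set X)}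
    (hB : ∀ b ∈ B, b.Nonempty) (hdisj : ∀ b ∈ B, ∀ c ∈ B, b ≠ c → b ∩ c = ∅)
    (hS : S ⊆ B) {b : Set X} (hb : b ∈ B) : b ∈ S ↔ b ⊆ ⋃₀ (S : Set (Set X)) := by
  refine ⟨fun h => Set.subset_sUnion_of_mem h, fun h => ?_⟩
  obtain ⟨x, hx⟩ := hB b hb
  obtain ⟨c, hcS, hxc⟩ := h hx
  by_contra hbS
  have hne : b ≠ c := fun e => hbS (e ▸ hcS)
  exact (hdisj b hb c (hS hcS) hne).subset ⟨hx, hxc⟩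

theorem stmt_10 {X : Type*} (F : Finset (Set X)) (hne : F.Nonempty)
    (hdiff : ∀ A ∈ F, ∀ D ∈ F, A \ D ∈ F)
    (hinter : ∀ A ∈ F, ∀ D ∈ F, A ∩ D ∈ F) :
    ∃ B : Finset (Set X), IsSetFamilyBasis F B ∧
      ∀ A ∈ F, ∃! S : Finset (Set X), S ⊆ B ∧ A = ⋃₀ (S : Set (Set X)) := by
  classical
  let B := F.filter (Minimal (fun c => c ∈ F ∧ c.Nonempty))
  have hmin {b} (hb : b ∈ B) : Minimal (fun c => c ∈ F ∧ c.Nonempty) b :=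
    (Finset.mem_filter.1 hb).2
  have hnonempty : ∀ b ∈ B, b.Nonempty := fun b hb => (hmin hb).prop.2
  have hdisj : ∀ b ∈ B, ∀ c ∈ B, b ≠ c → b ∩ c = ∅ := fun b hb c hc =>
    inter_eq_empty_of_minimal_of_ne hinter (hmin hb) (hmin hc)
  have hex : ∀ A ∈ F, ∃ S : Finset (Set X), S ⊆ B ∧ A = ⋃₀ (S : Set (Set X)) := by
    intro A hA
    refine ⟨B.filter (· ⊆ A), Finset.filter_subset _ _, Set.Subset.antisymm (fun x hx => ?_) ?_⟩
    · obtain ⟨b, hb, hxb, hbA⟩ := exists_minimal_nonempty_mem_subset hdiff hA hx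
      exact ⟨b, Finset.mem_filter.2 ⟨Finset.mem_filter.2 ⟨hb.prop.1, hb⟩, hbA⟩, hxb⟩
    · exact Set.sUnion_subset fun b hb => (Finset.mem_filter.1 hb).2
  refine ⟨B, ⟨fun b hb => (hmin hb).prop.1, hnonempty, hdisj, hex⟩, fun A hA => ?_⟩
  obtain ⟨S, hS, hAS⟩ := hex A hA
  refine ⟨S, ⟨hS, hAS⟩, fun T ⟨hT, hAT⟩ => ?_⟩
  have hmem {U : Finset (Set X)} (hU : U ⊆ B) {b : Set X} (hb : b ∈ B) :=
    mem_iff_subset_sUnion_of_disjoint hnonempty hdisj hU hb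
  ext b
  refine ⟨fun hb => ?_, fun hb => ?_⟩
  · rw [hmem hS (hT hb), ← hAS, hAT]
    exact (hmem hT (hT hb)).1 hb
  · rw [hmem hT (hS hb), ← hAT, hAS]
    exact (hmem hS (hS hb)).1 hb
end

section
/- Let F be a nonempty finite set of Boolean vectors f : Fin m → Bool such that for all f, g ∈ F, the pointwise abjunction j ↦ f j ∧ ¬(g j) belongs to F and the pointwise conjunction j ↦ f j ∧ g j belongs to F. Then F has a basis: there exists a finite collection V ⊆ F of vectors, each not identically false, which are pairwise orthogonal (for distinct u, v ∈ V there is no j with u j = true and v j = true), such that every f ∈ F equals the pointwise disjunction of the members of a unique subcollection S ⊆ V (with the empty subcollection giving the identically false vector). -/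
/-- In a finite family of Boolean vectors closed under abjunction and conjunction, every
coordinate covered by the family is covered by a member that each member either contains
or avoids. -/
theorem exists_indivisible_of_apply_eq_true {ι : Type*} {F : Finset (ι → Bool)}
    (habj : ∀ f ∈ F, ∀ g ∈ F, (fun j => f j && !(g j)) ∈ F)
    (hand : ∀ f ∈ F, ∀ g ∈ F, (fun j => f j && g j) ∈ F)
    {f : ι → Bool} (hf : f ∈ F) {j : ι} (hj : f j = true) :
    ∃ v ∈ F, v j = true ∧
      ∀ g ∈ F, (∀ i, v i = true → g i = true) ∨ (∀ i, v i = true → g i = false) := by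
  obtain ⟨v, hv⟩ := (F.filter fun g => g j = true).exists_minimal
    ⟨f, Finset.mem_filter.2 ⟨hf, hj⟩⟩
  obtain ⟨hvF, hvj⟩ := Finset.mem_filter.1 hv.prop
  refine ⟨v, hvF, hvj, fun g hg => ?_⟩
  cases hgj : g j with
  | true =>
    left
    intro i hi
    have h := hv.le_of_le (y := fun j => v j && g j)
      (Finset.mem_filter.2 ⟨hand v hvF g hg, by simp [hvj, hgj]⟩)
      (fun i => Bool.and_le_left _ _) i
    simpa [hi] using Bool.le_iff_imp.1 h hi
  | false =>
    right
    intro i hi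
    have h := hv.le_of_le (y := fun j => v j && !(g j))
      (Finset.mem_filter.2 ⟨habj v hvF g hg, by simp [hvj, hgj]⟩)
      (fun i => Bool.and_le_left _ _) i
    simpa [hi] using Bool.le_iff_imp.1 h hi

theorem stmt_11 (m : ℕ) (F : Finset (Fin m → Bool))
    (hne : F.Nonempty)
    (habj : ∀ f ∈ F, ∀ g ∈ F, (fun j => f j && !(g j)) ∈ F)
    (hand : ∀ f ∈ F, ∀ g ∈ F, (fun j => f j && g j) ∈ F) :
    ∃ V : Finset (Fin m → Bool), V ⊆ F ∧
      (∀ v ∈ V, v ≠ fun _ => false) ∧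
      (∀ u ∈ V, ∀ v ∈ V, u ≠ v → ∀ j : Fin m, ¬(u j = true ∧ v j = true)) ∧
      (∀ f ∈ F, ∃! S : Finset (Fin m → Bool),
        S ⊆ V ∧ ∀ j : Fin m, (f j = true ↔ ∃ v ∈ S, v j = true)) := by
  classical
  let V := F.filter fun v => (∃ j, v j = true) ∧
    ∀ g ∈ F, (∀ i, v i = true → g i = true) ∨ (∀ i, v i = true → g i = false)
  have hV : ∀ v, v ∈ V ↔ v ∈ F ∧ (∃ j, v j = true) ∧
      ∀ g ∈ F, (∀ i, v i = true → g i = true) ∨ (∀ i, v i = true → g i = false) :=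
    fun v => Finset.mem_filter
  have eq_of_common : ∀ u ∈ V, ∀ v ∈ V, ∀ j, u j = true → v j = true → u = v := by
    intro u hu v hv j huj hvj
    obtain ⟨huF, -, hu⟩ := (hV u).1 hu
    obtain ⟨hvF, -, hv⟩ := (hV v).1 hv
    have huv := (hu v hvF).resolve_right fun h => by simp [h j huj] at hvj
    have hvu := (hv u huF).resolve_right fun h => by simp [h j hvj] at huj
    funext i
    exact Bool.eq_iff_iff.2 ⟨huv i, hvu i⟩
  refine ⟨V, Finset.filter_subset _ _, ?_, ?_, ?_⟩
  · rintro v hv rfl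
    obtain ⟨-, ⟨j, hj⟩, -⟩ := (hV _).1 hv
    simp at hj
  · exact fun u hu v hv huv j h => huv (eq_of_common u hu v hv j h.1 h.2)
  · intro f hf
    refine ⟨V.filter fun v => ∀ i, v i = true → f i = true,
      ⟨Finset.filter_subset _ _, fun j => ⟨fun hj => ?_, ?_⟩⟩, ?_⟩
    · obtain ⟨v, hvF, hvj, hv⟩ := exists_indivisible_of_apply_eq_true habj hand hf hj
      exact ⟨v, Finset.mem_filter.2 ⟨(hV v).2 ⟨hvF, ⟨j, hvj⟩, hv⟩,
        (hv f hf).resolve_right fun h => by simp [h j hvj] at hj⟩, hvj⟩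
    · rintro ⟨v, hv, hvj⟩
      exact (Finset.mem_filter.1 hv).2 j hvj
    · rintro S ⟨hSV, hS⟩
      ext v
      rw [Finset.mem_filter]
      constructor
      · exact fun hv => ⟨hSV hv, fun i hi => (hS i).2 ⟨v, hv, hi⟩⟩
      · rintro ⟨hv, hvf⟩
        obtain ⟨-, ⟨j, hj⟩, -⟩ := (hV v).1 hv
        obtain ⟨w, hw, hwj⟩ := (hS j).1 (hvf j hj)
        rwa [eq_of_common v hv w (hSV hw) j hj hwj]
end

section
/- Let F be a nonempty finite set of Boolean vectors f : Fin m → Bool containing at least one vector that is not identically false, and suppose F is closed under pointwise material conditional: for all f, g ∈ F, the vector j ↦ (¬(f j) ∨ g j) belongs to F. Then there exists a column j : Fin m such that 2 * |{f ∈ F : f j = true}| ≥ |F|, i.e., at least half of the rows have a one in column j. -/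
/-- In a family closed under material conditional, above a member `g` that is false at `j` there is
a member that is true at `j` and agrees with `g` on the columns of `s` not identical to column `j`. -/
lemma exists_mem_true_agreeing {ι : Type*} [DecidableEq ι] {F : Finset (ι → Bool)}
    (himp : ∀ f ∈ F, ∀ g ∈ F, (fun j => !(f j) || g j) ∈ F) {j : ι} {g : ι → Bool}
    (hg : g ∈ F) (hgj : g j = false) (s : Finset ι) :
    ∃ h ∈ F, h j = true ∧ (∀ i, g i = true → h i = true) ∧
      ∀ i ∈ s, (∃ f ∈ F, f i ≠ f j) → h i = g i := by
  induction s using Finset.induction_on with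
  | empty => exact ⟨_, himp g hg g hg, by simp [hgj], by simp, by simp⟩
  | insert a s _ ih =>
    obtain ⟨h, hF, hj, hle, hs⟩ := ih
    by_cases ha : ∃ f ∈ F, f a ≠ f j
    · obtain ⟨k, hkF, hkj, hkle, hka⟩ : ∃ k ∈ F, k j = true ∧
          (∀ i, g i = true → k i = true) ∧ k a = g a := by
        obtain ⟨f, hf, hfa⟩ := ha
        cases hfj : f j with
        | false =>
          refine ⟨_, himp f hf g hg, by simp [hfj], fun i hi => by simp [hi], ?_⟩
          simp_all
        | true =>
          refine ⟨_, himp _ (himp f hf g hg) g hg, by simp [hfj], fun i hi => by simp [hi], ?_⟩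
          simp_all
      -- The meet of `h` and `k`, both of which lie above `g`.
      have key : ∀ i, (!(!(h i) || (!(k i) || g i)) || g i) = (h i && k i) := by
        intro i
        have h1 := hle i
        have h2 := hkle i
        cases hi : h i <;> cases ki : k i <;> cases gi : g i <;> simp_all
      have hmem := himp _ (himp h hF _ (himp k hkF g hg)) g hg
      simp only [key] at hmem
      refine ⟨_, hmem, by simp [hj, hkj], fun i hi => by simp [hle i hi, hkle i hi], ?_⟩
      intro i hi hsep
      have h1 := hle i
      have h2 := hkle i
      rcases Finset.mem_insert.mp hi with rfl | hi
      · cases gi : g i <;> simp_all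
      · have h3 := hs i hi hsep
        cases gi : g i <;> simp_all
    · refine ⟨h, hF, hj, hle, fun i hi hsep => ?_⟩
      rcases Finset.mem_insert.mp hi with rfl | hi
      · exact absurd hsep ha
      · exact hs i hi hsep

/-- In a family closed under material conditional, every column has at least as many ones as
zeros. -/
lemma card_filter_false_le_card_filter_true {ι : Type*} [Fintype ι] [DecidableEq ι]
    {F : Finset (ι → Bool)}
    (himp : ∀ f ∈ F, ∀ g ∈ F, (fun j => !(f j) || g j) ∈ F) (j : ι) :
    (F.filter (fun f => ¬ f j = true)).card ≤ (F.filter (fun f => f j = true)).card := by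
  have hex : ∀ g : ι → Bool, ∃ h : ι → Bool, g ∈ F → g j = false →
      h ∈ F ∧ h j = true ∧ ∀ i, (∃ f ∈ F, f i ≠ f j) → h i = g i := by
    intro g
    by_cases hg : g ∈ F ∧ g j = false
    · obtain ⟨h, h1, h2, _, h4⟩ := exists_mem_true_agreeing himp hg.1 hg.2 Finset.univ
      exact ⟨h, fun _ _ => ⟨h1, h2, fun i => h4 i (Finset.mem_univ i)⟩⟩
    · exact ⟨g, fun h1 h2 => absurd ⟨h1, h2⟩ hg⟩
  choose φ hφ using hex
  refine Finset.card_le_card_of_injOn φ ?_ ?_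
  · intro g hg
    simp only [Finset.coe_filter, Set.mem_ofPred_eq, Bool.not_eq_true] at hg ⊢
    obtain ⟨h1, h2, _⟩ := hφ g hg.1 hg.2
    exact ⟨h1, h2⟩
  · intro g hg g' hg' heq
    simp only [Finset.coe_filter, Set.mem_ofPred_eq, Bool.not_eq_true] at hg hg'
    funext i
    by_cases hi : ∃ f ∈ F, f i ≠ f j
    · rw [← (hφ g hg.1 hg.2).2.2 i hi, ← (hφ g' hg'.1 hg'.2).2.2 i hi, heq]
    · push Not at hi
      rw [hi g hg.1, hi g' hg'.1, hg.2, hg'.2]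

theorem stmt_13 (m : ℕ) (F : Finset (Fin m → Bool))
    (hne : F.Nonempty)
    (hnz : ∃ f ∈ F, f ≠ fun _ => false)
    (himp : ∀ f ∈ F, ∀ g ∈ F, (fun j => !(f j) || g j) ∈ F) :
    ∃ j : Fin m, 2 * (F.filter (fun f => f j = true)).card ≥ F.card := by
  obtain ⟨f, _, hf⟩ := hnz
  obtain ⟨j, _⟩ := Function.ne_iff.mp hf
  refine ⟨j, ?_⟩
  have hle := card_filter_false_le_card_filter_true himp j
  have hsum := F.card_filter_add_card_filter_not (fun f => f j = true)
  omega
end
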